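/- arXiv:1311.5883 — 2 statements merged into one kernel-verified Lean document; each statement's English description precedes it below -/
import Mathlib

section
/- Let U be a subcritical update family in two dimensions and let A ~ Bin(ℤ², p). Then ℙ_p(0 ∈ [A]) → 0 as p → 0. -/
open Set MeasureTheory

/-- A site of the two-dimensional lattice. -/
abbrev Site : Type := ℤ × ℤ

/-- One step of the `U`-bootstrap process. -/
def bsStep (U : Finset (Finset Site)) (A : Set Site) : Set Site :=
  A ∪ {x : Site | ∃ X ∈ U, ∀ y ∈ X, y + x ∈ A}

/-- The `t`-th stage of the `U`-bootstrap process started from `A`. -/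
def bsIter (U : Finset (Finset Site)) : ℕ → Set Site → Set Site
  | 0, A => A
  | n + 1, A => bsStep U (bsIter U n A)

/-- The closure `[A]` under the `U`-bootstrap process. -/
def bsClosure (U : Finset (Finset Site)) (A : Set Site) : Set Site :=
  ⋃ n : ℕ, bsIter U n A

/-- `U` is an update family: a (finite) collection of finite nonempty subsets of `ℤ² \ {0}`. -/
def IsUpdateFamily (U : Finset (Finset Site)) : Prop :=
  U.Nonempty ∧ ∀ X ∈ U, X.Nonempty ∧ (0 : Site) ∉ X

/-- The discrete half-plane `H_u` determined by `u ∈ ℝ²`. -/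
def halfPlane (u : ℝ × ℝ) : Set Site :=
  {x : Site | (x.1 : ℝ) * u.1 + (x.2 : ℝ) * u.2 < 0}

/-- A direction `u` is stable for `U` if `[H_u] = H_u`. -/
def IsStableDir (U : Finset (Finset Site)) (u : ℝ × ℝ) : Prop :=
  bsClosure U (halfPlane u) = halfPlane u

/-- The unit vector of angle `θ`. -/
noncomputable def dir (θ : ℝ) : ℝ × ℝ := (Real.cos θ, Real.sin θ)

/-- `dir θ` lies in the interior of the stable set (is strongly stable). -/
def IsStronglyStableAngle (U : Finset (Finset Site)) (θ : ℝ) : Prop :=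
  ∃ ε > 0, ∀ φ : ℝ, |φ - θ| < ε → IsStableDir U (dir φ)

/-- `U` is subcritical: every open semicircle contains a strongly stable direction. -/
def Subcritical (U : Finset (Finset Site)) : Prop :=
  ∀ θ : ℝ, ∃ φ : ℝ, θ < φ ∧ φ < θ + Real.pi ∧ IsStronglyStableAngle U φ

/-- `U` is supercritical: some open semicircle contains no stable direction. -/
def Supercritical (U : Finset (Finset Site)) : Prop :=
  ∃ θ : ℝ, ∀ φ : ℝ, θ < φ → φ < θ + Real.pi → ¬ IsStableDir U (dir φ)

/-- The random set of infected sites determined by `ω`. -/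
def siteSet (ω : Site → Bool) : Set Site := {x : Site | ω x = true}

/-- `μ` is the Bernoulli product measure with density `p` on `ℤ²`:
each site lies in the random set independently with probability `p`. -/
def IsBernoulli (p : ℝ) (μ : Measure (Site → Bool)) : Prop :=
  ∀ (s : Finset Site) (f : Site → Bool),
    μ {ω : Site → Bool | ∀ x ∈ s, ω x = f x}
      = ∏ x ∈ s, ENNReal.ofReal (if f x then p else 1 - p)

/-- `A` percolates: its closure is all of `ℤ²`. -/
def Percolates (U : Finset (Finset Site)) (A : Set Site) : Prop :=
  bsClosure U A = Set.univ

/-- The critical probability `p_c(ℤ², U)`. -/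
noncomputable def critProb (U : Finset (Finset Site)) : ℝ :=
  sInf {p : ℝ | p ∈ Set.Icc (0 : ℝ) 1 ∧
    ∀ μ : Measure (Site → Bool), IsBernoulli p μ →
      μ {ω : Site → Bool | Percolates U (siteSet ω)} = 1}

/-- Euclidean embedding of the lattice into the complex plane. -/
noncomputable def toC (v : Site) : ℂ := ⟨(v.1 : ℝ), (v.2 : ℝ)⟩

/-- The range `r(U)`: the largest Euclidean distance between two sites of one update rule. -/
noncomputable def famRange (U : Finset (Finset Site)) : ℝ :=
  (U.sup fun X => X.sup fun a => X.sup fun b => nndist (toC a) (toC b) : NNReal)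

/-! ### Tours: closed walks with steps in a prescribed set -/

/-- The sites visited by the walk started at `x` with the given list of steps. -/
def visited : Site → List Site → Finset Site
  | x, [] => {x}
  | x, d :: l => insert x (visited (x + d) l)

lemma start_mem_visited (x : Site) (l : List Site) : x ∈ visited x l := by
  cases l <;> simp [visited]

lemma visited_append (x : Site) (l₁ l₂ : List Site) :
    visited x (l₁ ++ l₂) = visited x l₁ ∪ visited (x + l₁.sum) l₂ := by
  induction l₁ generalizing x with
  | nil =>
    simp only [List.nil_append, visited, List.sum_nil, add_zero]
    rw [← Finset.insert_eq, Finset.insert_eq_self.2 (start_mem_visited _ _)]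
  | cons d l ih => simp [visited, ih, add_assoc]

lemma exists_split_of_mem_visited {x y : Site} {l : List Site} (h : y ∈ visited x l) :
    ∃ l₁ l₂, l = l₁ ++ l₂ ∧ x + l₁.sum = y := by
  induction l generalizing x with
  | nil =>
    simp only [visited, Finset.mem_singleton] at h
    exact ⟨[], [], rfl, by simp [h]⟩
  | cons d l ih =>
    simp only [visited, Finset.mem_insert] at h
    rcases h with rfl | h
    · exact ⟨[], d :: l, rfl, by simp⟩
    · obtain ⟨l₁, l₂, rfl, hs⟩ := ih h
      exact ⟨d :: l₁, l₂, rfl, by simpa [add_assoc] using hs⟩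

lemma card_visited_le (x : Site) (l : List Site) : (visited x l).card ≤ l.length + 1 := by
  induction l generalizing x with
  | nil => simp [visited]
  | cons d l ih =>
    simp only [visited, List.length_cons]
    exact (Finset.card_insert_le _ _).trans (Nat.add_le_add_right (ih _) 1)

/-- There is a closed walk from `x` with steps in `D`, of length at most `k`, visiting all of
`S`. -/
def Tour (D : Finset Site) (x : Site) (k : ℝ) (S : Set Site) : Prop :=
  ∃ l : List Site, (l.length : ℝ) ≤ k ∧ (∀ d ∈ l, d ∈ D) ∧ l.sum = 0 ∧
    S ⊆ (visited x l : Set Site)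

namespace Tour

variable {D : Finset Site} {x y : Site} {k k' : ℝ} {S S' : Set Site}

lemma mono (h : Tour D x k S) (hk : k ≤ k') (hS : S' ⊆ S) : Tour D x k' S' := by
  obtain ⟨l, h1, h2, h3, h4⟩ := h
  exact ⟨l, h1.trans hk, h2, h3, hS.trans h4⟩

lemma refl (D : Finset Site) (x : Site) : Tour D x 0 {x} :=
  ⟨[], by simp, by simp, by simp, by simp [visited]⟩

lemma graft (h : Tour D x k S) (hy : y ∈ S) (h' : Tour D y k' S') :
    Tour D x (k + k') (S ∪ S') := by
  obtain ⟨l, h1, h2, h3, h4⟩ := h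
  obtain ⟨m, g1, g2, g3, g4⟩ := h'
  obtain ⟨l₁, l₂, rfl, hs⟩ := exists_split_of_mem_visited (h4 hy)
  rw [visited_append, hs] at h4
  refine ⟨l₁ ++ (m ++ l₂), ?_, ?_, ?_, ?_⟩
  · simp only [List.length_append, Nat.cast_add] at h1 ⊢
    linarith
  · intro d hd
    simp only [List.mem_append] at hd h2
    rcases hd with hd | hd | hd
    · exact h2 d (Or.inl hd)
    · exact g2 d hd
    · exact h2 d (Or.inr hd)
  · simpa [g3] using h3
  · rw [visited_append, visited_append, hs, g3, add_zero]
    intro z hz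
    simp only [Finset.coe_union, Set.mem_union] at h4 ⊢
    rcases hz with hz | hz
    · rcases h4 hz with h | h
      · exact Or.inl h
      · exact Or.inr (Or.inr h)
    · exact Or.inr (Or.inl (g4 hz))

lemma rebase (h : Tour D x k S) (hy : y ∈ S) : Tour D y k S := by
  obtain ⟨l, h1, h2, h3, h4⟩ := h
  obtain ⟨l₁, l₂, rfl, hs⟩ := exists_split_of_mem_visited (h4 hy)
  have hx : y + l₂.sum = x := by
    rw [← hs, add_assoc, ← List.sum_append, h3, add_zero]
  rw [visited_append, hs] at h4
  refine ⟨l₂ ++ l₁, ?_, ?_, ?_, ?_⟩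
  · simpa [add_comm] using h1
  · intro d hd
    exact h2 d (by simpa [or_comm] using hd)
  · rw [List.sum_append, add_comm, ← List.sum_append, h3]
  · rw [visited_append, hx, Finset.union_comm]
    exact h4

lemma edge (hD : ∀ d ∈ D, -d ∈ D) (h : y - x ∈ D) : Tour D x 2 {x, y} := by
  refine ⟨[y - x, x - y], by norm_num, ?_, by simp, ?_⟩
  · have := hD _ h
    rw [neg_sub] at this
    simp [h, this]
  · intro z hz
    simp only [Set.mem_insert_iff, Set.mem_singleton_iff] at hz
    rcases hz with rfl | rfl <;> simp [visited]

lemma biUnion {ι : Type*} (s : Finset ι) (k : ι → ℝ) (S : ι → Set Site)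
    (h : ∀ i ∈ s, Tour D x (k i) (S i)) :
    Tour D x (∑ i ∈ s, k i) ({x} ∪ ⋃ i ∈ s, S i) := by
  classical
  induction s using Finset.induction_on with
  | empty => simpa using refl D x
  | insert a s ha ih =>
    have h1 := ih fun i hi => h i (Finset.mem_insert_of_mem hi)
    have h2 := h1.graft (Or.inl rfl) (h a (Finset.mem_insert_self _ _))
    refine h2.mono (by rw [Finset.sum_insert ha, add_comm]) ?_
    rw [Finset.set_biUnion_insert]
    intro z hz
    simp only [Set.mem_union] at hz ⊢
    tauto

end Tour

/-! ### Explanations of infected sites -/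

/-- An explanation of the sites of `V` from the sites of `A`: every site `x ∈ V \ A` comes with
children `f s x ∈ V` of smaller rank `τ`, the child of charge `s` increasing `L s` by at
least `1`. -/
structure IsExplanation {ι : Type*} (A V : Set Site) (D : Finset Site) (L : ι → Site →+ ℝ)
    (τ : Site → ℕ) (f : ι → Site → Site) : Prop where
  subset : A ⊆ V
  fixed : ∀ s, ∀ x ∈ A, f s x = x
  mem : ∀ s, ∀ x ∈ V, f s x ∈ V
  rank_lt : ∀ s, ∀ x ∈ V, x ∉ A → τ (f s x) < τ x
  step_mem : ∀ s, ∀ x ∈ V, f s x - x ∈ D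
  sibling_mem : ∀ s s', ∀ x ∈ V, f s x - f s' x ∈ D
  gain : ∀ s, ∀ x ∈ V, x ∉ A → L s x + 1 ≤ L s (f s x)

/-- `K` is matchable if every tuple of starting points in `K`, one for each charge, can be
completed by tuples of bounded diameter in such a way that, for every charge, the paths from the
starting points of this charge end bijectively at the sites of `K ∩ A`. -/
def Matchable {ι : Type*} (A V : Set Site) (D : Finset Site) (φ : ι → Site → Site)
    (K : Set Site) : Prop :=
  ∀ v : ι → Site, (∀ s, v s ∈ K) → ∃ (B : Finset Site) (T : Multiset (ι → Site)),
    (B : Set Site) = K ∩ A ∧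
    (∀ t ∈ T, (∀ s, t s ∈ V) ∧ ∀ s s', t s - t s' ∈ D) ∧
    ∀ s, φ s (v s) ::ₘ T.map (fun t => φ s (t s)) = B.val

namespace Matchable

variable {ι : Type*} {A V : Set Site} {D : Finset Site} {φ : ι → Site → Site} {K K' : Set Site}

lemma empty [Nonempty ι] : Matchable A V D φ ∅ :=
  fun _ hv => (hv (Classical.arbitrary ι)).elim

lemma singleton {b : Site} (hb : b ∈ A) (hφ : ∀ s, φ s b = b) : Matchable A V D φ {b} := by
  intro v hv
  refine ⟨{b}, 0, ?_, by simp, ?_⟩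
  · ext z
    simp only [Finset.coe_singleton, Set.mem_singleton_iff, Set.mem_inter_iff]
    exact ⟨fun h => ⟨h, h ▸ hb⟩, fun h => h.1⟩
  · intro s
    have : v s = b := hv s
    simp [this, hφ]

lemma insert {w : Site} (h : Matchable A V D φ K) (hw : w ∉ A) (c : ι → Site)
    (hc : ∀ s, c s ∈ K) (hφ : ∀ s, φ s (c s) = φ s w) : Matchable A V D φ (insert w K) := by
  classical
  intro v hv
  obtain ⟨B, T, hB, hT, hm⟩ := h (fun s => if v s = w then c s else v s) (by
    intro s
    by_cases hs : v s = w
    · simp [hs, hc]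
    · simpa [hs] using hv s)
  refine ⟨B, T, ?_, hT, ?_⟩
  · rw [hB, Set.insert_inter_of_notMem hw]
  · intro s
    rw [← hm s]
    by_cases hs : v s = w
    · simp [hs, hφ]
    · simp [hs]

lemma union (h : Matchable A V D φ K) (h' : Matchable A V D φ K') (hd : Disjoint K K')
    {c c' : Site} (hc : c ∈ K) (hc' : c' ∈ K') (hcV : c ∈ V) (hcV' : c' ∈ V) (h0 : 0 ∈ D)
    (hcc : c - c' ∈ D) (hcc' : c' - c ∈ D) : Matchable A V D φ (K ∪ K') := by
  classical
  intro v hv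
  obtain ⟨B, T, hB, hT, hm⟩ := h (fun s => if v s ∈ K then v s else c) (by
    intro s
    by_cases hs : v s ∈ K <;> simp [hs, hc])
  obtain ⟨B', T', hB', hT', hm'⟩ := h' (fun s => if v s ∈ K then c' else v s) (by
    intro s
    by_cases hs : v s ∈ K
    · simp [hs, hc']
    · simpa [hs] using (hv s).resolve_left hs)
  have hBB : Disjoint B B' := by
    rw [← Finset.disjoint_coe, hB, hB']
    exact hd.mono inter_subset_left inter_subset_left
  refine ⟨B.disjUnion B' hBB, (fun s => if v s ∈ K then c' else c) ::ₘ (T + T'), ?_, ?_, ?_⟩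
  · rw [Finset.coe_disjUnion, hB, hB', Set.union_inter_distrib_right]
  · intro t ht
    rw [Multiset.mem_cons, Multiset.mem_add] at ht
    rcases ht with rfl | ht | ht
    · refine ⟨fun s => ?_, fun s s' => ?_⟩
      · by_cases hs : v s ∈ K <;> simp [hs, hcV, hcV']
      · by_cases hs : v s ∈ K <;> by_cases hs' : v s' ∈ K <;> simp [hs, hs', h0, hcc, hcc']
    · exact hT t ht
    · exact hT' t ht
  · intro s
    have e : (B.disjUnion B' hBB).val = B.val + B'.val := rfl
    rw [e, ← hm s, ← hm' s]
    by_cases hs : v s ∈ K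
    · simp only [hs, if_true, Multiset.map_cons, Multiset.map_add, Multiset.cons_add,
        Multiset.add_cons]
      rw [Multiset.cons_swap]
    · simp only [hs, if_false, Multiset.map_cons, Multiset.map_add, Multiset.cons_add,
        Multiset.add_cons]

end Matchable

namespace IsExplanation

variable {ι : Type*} {A V : Set Site} {D : Finset Site} {L : ι → Site →+ ℝ} {τ : Site → ℕ}
  {f : ι → Site → Site}

lemma iterate_fixed (h : IsExplanation A V D L τ f) (s : ι) {x : Site} (hx : x ∈ A) (n : ℕ) :
    (f s)^[n] x = x :=
  Function.iterate_fixed (h.fixed s x hx) n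

lemma iterate_mem_of_rank_le (h : IsExplanation A V D L τ f) (s : ι) {x : Site} (hx : x ∈ V)
    {n : ℕ} (hn : τ x ≤ n) : (f s)^[n] x ∈ A := by
  induction n generalizing x with
  | zero =>
    by_contra hA
    have := h.rank_lt s x hx hA
    omega
  | succ n ih =>
    by_cases hA : x ∈ A
    · rwa [h.iterate_fixed s hA]
    · exact ih (h.mem s x hx) (by have := h.rank_lt s x hx hA; omega)

lemma iterate_step (h : IsExplanation A V D L τ f) (s : ι) {x : Site} (hx : x ∈ V)
    {n : ℕ} (hn : τ x ≤ n) : (f s)^[n] (f s x) = (f s)^[n] x := by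
  rw [← Function.iterate_succ_apply, Function.iterate_succ_apply',
    h.fixed s _ (h.iterate_mem_of_rank_le s hx hn)]

lemma tour_path (h : IsExplanation A V D L τ f) (hD : ∀ d ∈ D, -d ∈ D) (s : ι) {x : Site}
    (hx : x ∈ V) (n : ℕ) :
    Tour D x (2 * (L s ((f s)^[n] x) - L s x)) {x, (f s)^[n] x} := by
  induction n generalizing x with
  | zero => simpa using Tour.refl D x
  | succ n ih =>
    rw [Function.iterate_succ_apply]
    by_cases hA : x ∈ A
    · rw [h.fixed s x hA]
      exact ih hx
    · have h1 := (Tour.edge hD (h.step_mem s x hx)).graft (Or.inr rfl) (ih (h.mem s x hx))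
      refine h1.mono (by linarith [h.gain s x hx hA]) ?_
      intro z hz
      simp only [Set.mem_insert_iff, Set.mem_singleton_iff, Set.mem_union] at hz ⊢
      tauto

lemma exists_finset_closed [Fintype ι] (h : IsExplanation A V D L τ f) {x : Site} (hx : x ∈ V) :
    ∃ F : Finset Site, x ∈ F ∧ (∀ y ∈ F, y ∈ V ∧ τ y ≤ τ x) ∧ ∀ y ∈ F, ∀ s, f s y ∈ F := by
  classical
  induction hn : τ x using Nat.strong_induction_on generalizing x with
  | _ n ih =>
    subst hn
    by_cases hA : x ∈ A
    · refine ⟨{x}, by simp, by simpa using hx, ?_⟩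
      intro y hy s
      rw [Finset.mem_singleton] at hy
      simp [hy, h.fixed s x hA]
    · choose F hxF hF hcl using fun s => ih _ (h.rank_lt s x hx hA) (h.mem s x hx) rfl
      refine ⟨insert x (Finset.univ.biUnion F), by simp, ?_, ?_⟩
      · intro y hy
        simp only [Finset.mem_insert, Finset.mem_biUnion, Finset.mem_univ, true_and] at hy
        rcases hy with rfl | ⟨s, hs⟩
        · exact ⟨hx, le_rfl⟩
        · exact ⟨(hF s y hs).1, (hF s y hs).2.trans (h.rank_lt s x hx hA).le⟩
      · intro y hy s
        simp only [Finset.mem_insert, Finset.mem_biUnion, Finset.mem_univ, true_and] at hy ⊢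
        rcases hy with rfl | ⟨s', hs⟩
        · exact Or.inr ⟨s, hxF s⟩
        · exact Or.inr ⟨s', hcl s' y hs s⟩

/-- Every finite set of explained sites closed under taking children can be partitioned, by a
labelling `κ`, into matchable sets. -/
lemma exists_partition [Fintype ι] [Nonempty ι] (h : IsExplanation A V D L τ f)
    (h0 : (0 : Site) ∈ D) (n : ℕ) (F : Finset Site) (hF : ∀ y ∈ F, y ∈ V ∧ τ y ≤ n)
    (hcl : ∀ y ∈ F, ∀ s, f s y ∈ F) :
    ∃ κ : Site → ℕ, ∀ j, Matchable A V D (fun s => (f s)^[n]) {x | x ∈ F ∧ κ x = j} := by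
  classical
  induction hc : F.card generalizing F with
  | zero =>
    rw [Finset.card_eq_zero] at hc
    subst hc
    refine ⟨fun _ => 0, fun j => ?_⟩
    simpa using Matchable.empty
  | succ m ih =>
    obtain ⟨w, hwF, hwmax⟩ := F.exists_max_image τ (Finset.card_pos.1 (by omega))
    have hne : ∀ y ∈ F, y ≠ w → ∀ s, f s y ≠ w := by
      intro y hy hyw s he
      by_cases hA : y ∈ A
      · exact hyw ((h.fixed s y hA).symm.trans he)
      · have := h.rank_lt s y (hF y hy).1 hA
        rw [he] at this
        exact absurd (hwmax y hy) (by omega)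
    obtain ⟨κ, hκ⟩ := ih (F.erase w) (fun y hy => hF y (Finset.mem_of_mem_erase hy))
      (fun y hy s => Finset.mem_erase.2 ⟨hne y (Finset.mem_of_mem_erase hy)
        (Finset.ne_of_mem_erase hy) s, hcl y (Finset.mem_of_mem_erase hy) s⟩)
      (by rw [Finset.card_erase_of_mem hwF]; omega)
    by_cases hA : w ∈ A
    · obtain ⟨i, hi⟩ := Infinite.exists_notMem_finset (F.image κ)
      refine ⟨Function.update κ w i, fun j => ?_⟩
      by_cases hj : j = i
      · have e : {x | x ∈ F ∧ Function.update κ w i x = j} = {w} := by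
          ext x
          by_cases hx : x = w
          · simp [hx, hwF, hj]
          · simp only [Set.mem_ofPred_eq, Function.update_of_ne hx, Set.mem_singleton_iff, hx,
              iff_false, not_and]
            rintro hxF rfl
            exact hi (hj ▸ Finset.mem_image_of_mem κ hxF)
        rw [e]
        exact Matchable.singleton hA fun s => h.iterate_fixed s hA n
      · convert hκ j using 1
        ext x
        by_cases hx : x = w
        · simp [hx, Ne.symm hj]
        · simp [hx]
    · have hcF : ∀ s, f s w ∈ F.erase w := fun s => Finset.mem_erase.2
        ⟨fun he => by
          have := h.rank_lt s w (hF w hwF).1 hA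
          rw [he] at this
          omega, hcl w hwF s⟩
      have hwV := (hF w hwF).1
      have hmerge : ∀ S : Finset ι, ∃ κ : Site → ℕ,
          (∀ j, Matchable A V D (fun s => (f s)^[n]) {x | x ∈ F.erase w ∧ κ x = j}) ∧
          ∀ s ∈ S, ∀ s' ∈ S, κ (f s w) = κ (f s' w) := by
        intro S
        induction S using Finset.induction_on with
        | empty => exact ⟨κ, hκ, by simp⟩
        | insert a S ha ihS =>
          obtain ⟨κ, hκ, hS⟩ := ihS
          by_cases hall : ∀ s ∈ S, κ (f s w) = κ (f a w)
          · refine ⟨κ, hκ, ?_⟩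
            intro s hs s' hs'
            rw [Finset.mem_insert] at hs hs'
            have key : ∀ s, s = a ∨ s ∈ S → κ (f s w) = κ (f a w) := by
              rintro s (rfl | hs)
              · rfl
              · exact hall s hs
            rw [key s hs, key s' hs']
          · push Not at hall
            obtain ⟨b, hb, hba⟩ := hall
            refine ⟨fun x => if κ x = κ (f a w) then κ (f b w) else κ x, ?_, ?_⟩
            · intro j
              by_cases hj : j = κ (f b w)
              · have e : {x | x ∈ F.erase w ∧
                    (if κ x = κ (f a w) then κ (f b w) else κ x) = j} =
                    {x | x ∈ F.erase w ∧ κ x = κ (f a w)} ∪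
                      {x | x ∈ F.erase w ∧ κ x = κ (f b w)} := by
                  ext x
                  simp only [Set.mem_ofPred_eq, Set.mem_union]
                  by_cases hx : κ x = κ (f a w) <;> (simp [hx, hj]; try tauto)
                rw [e]
                refine (hκ _).union (hκ _) ?_ (c := f a w) (c' := f b w) ⟨hcF a, rfl⟩
                  ⟨hcF b, rfl⟩ (h.mem a w hwV) (h.mem b w hwV) h0
                  (h.sibling_mem a b w hwV) (h.sibling_mem b a w hwV)
                rw [Set.disjoint_left]
                rintro x ⟨_, hx⟩ ⟨_, hx'⟩
                exact hba (hx'.symm.trans hx)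
              · by_cases hja : j = κ (f a w)
                · have e : {x | x ∈ F.erase w ∧
                      (if κ x = κ (f a w) then κ (f b w) else κ x) = j} = ∅ := by
                    ext x
                    simp only [Set.mem_ofPred_eq, Set.mem_empty_iff_false, iff_false, not_and]
                    intro _
                    split_ifs with hx
                    · exact fun he => hj he.symm
                    · exact fun he => hx (he.trans hja)
                  rw [e]
                  exact Matchable.empty
                · convert hκ j using 1
                  ext x
                  simp only [Set.mem_ofPred_eq, and_congr_right_iff]
                  intro _
                  split_ifs with hx
                  · exact ⟨fun he => (hj he.symm).elim, fun he => (hja (he.symm.trans hx)).elim⟩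
                  · rfl
            · have key : ∀ s, s = a ∨ s ∈ S →
                  (if κ (f s w) = κ (f a w) then κ (f b w) else κ (f s w)) = κ (f b w) := by
                rintro s (rfl | hs)
                · simp
                · rw [hS s hs b hb, if_neg hba]
              intro s hs s' hs'
              rw [Finset.mem_insert] at hs hs'
              simp only [key s hs, key s' hs']
      obtain ⟨κ, hκ, hS⟩ := hmerge Finset.univ
      let a : ι := Classical.arbitrary ι
      refine ⟨Function.update κ w (κ (f a w)), fun j => ?_⟩
      by_cases hj : j = κ (f a w)
      · have e : {x | x ∈ F ∧ Function.update κ w (κ (f a w)) x = j} =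
            insert w {x | x ∈ F.erase w ∧ κ x = j} := by
          ext x
          by_cases hx : x = w
          · simp [hx, hwF, hj]
          · simp [hx]
        rw [e]
        refine (hκ j).insert hA (fun s => f s w) (fun s => ⟨hcF s, ?_⟩) (fun s => ?_)
        · rw [hj]
          exact hS s (Finset.mem_univ _) a (Finset.mem_univ _)
        · exact h.iterate_step s hwV (hF w hwF).2
      · convert hκ j using 1
        ext x
        by_cases hx : x = w
        · simp [hx, Ne.symm hj]
        · simp [hx]

end IsExplanation

namespace IsExplanation

variable {ι : Type*} [Fintype ι] {A V : Set Site} {D : Finset Site} {L : ι → Site →+ ℝ}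
  {τ : Site → ℕ} {f : ι → Site → Site}

lemma tour_tuple (h : IsExplanation A V D L τ f) (hD : ∀ d ∈ D, -d ∈ D) (n : ℕ)
    {t : ι → Site} (htV : ∀ s, t s ∈ V) {x : Site} (htx : ∀ s, t s - x ∈ D) :
    Tour D x (∑ s, (2 + 2 * (L s ((f s)^[n] (t s)) - L s (t s))))
      (insert x (range fun s => (f s)^[n] (t s))) := by
  have h1 : ∀ s ∈ (Finset.univ : Finset ι),
      Tour D x (2 + 2 * (L s ((f s)^[n] (t s)) - L s (t s)))
        ({x, t s} ∪ {t s, (f s)^[n] (t s)}) := fun s _ =>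
    (Tour.edge hD (htx s)).graft (Or.inr rfl) (h.tour_path hD s (htV s) n)
  refine (Tour.biUnion _ _ _ h1).mono le_rfl ?_
  rintro z (rfl | ⟨s, rfl⟩)
  · exact Or.inl rfl
  · exact Or.inr (Set.mem_biUnion (Finset.mem_univ s) (Or.inr (Or.inr rfl)))

/-- Given an explanation of the origin, some tour from the origin visits a number of sites of `A`
proportional to its length. -/
theorem exists_tour [Nonempty ι] (h : IsExplanation A V D L τ f) (hD : ∀ d ∈ D, -d ∈ D)
    (h0 : (0 : Site) ∈ D) (hL : ∀ x, ∑ s, L s x = 0) {M : ℝ} (hM : ∀ d ∈ D, ∀ s, |L s d| ≤ M)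
    (h0V : (0 : Site) ∈ V) :
    ∃ B : Finset Site, B.Nonempty ∧ (B : Set Site) ⊆ A ∧
      Tour D 0 (2 * Fintype.card ι * (1 + M) * B.card) B := by
  classical
  obtain ⟨F, h0F, hF, hcl⟩ := h.exists_finset_closed h0V
  set n := τ 0
  obtain ⟨κ, hκ⟩ := h.exists_partition h0 n F hF hcl
  obtain ⟨B, T, hBA, hT, hmap⟩ := hκ (κ 0) (fun _ => 0) fun _ => ⟨h0F, rfl⟩
  set φ : ι → Site → Site := fun s => (f s)^[n]
  set S : Multiset (ι → Site) := (fun _ => 0) ::ₘ T with hS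
  have hSV : ∀ t ∈ S, (∀ s, t s ∈ V) ∧ ∀ s s', t s - t s' ∈ D := by
    intro t ht
    rcases Multiset.mem_cons.1 ht with rfl | ht
    · simp [h0, h0V]
    · exact hT t ht
  have hSmap : ∀ s, S.map (fun t => φ s (t s)) = B.val := by
    intro s
    rw [hS, Multiset.map_cons]
    exact hmap s
  let cost : (ι → Site) → ℝ := fun t => ∑ s, (2 + 2 * (L s (φ s (t s)) - L s (t s)))
  let sinks : Multiset (ι → Site) → Set Site := fun R => {b | ∃ t ∈ R, ∃ s, φ s (t s) = b}
  let good : Set (Multiset (ι → Site)) :=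
    {R | R ≤ S ∧ (fun _ => 0) ∈ R ∧ Tour D 0 (R.map cost).sum (sinks R)}
  have hfin : good.Finite := (Set.finite_Iic S).subset fun R hR => hR.1
  have hne : good.Nonempty := by
    refine ⟨{fun _ => 0}, ?_, by simp, ?_⟩
    · rw [Multiset.singleton_le]
      exact Multiset.mem_cons_self _ _
    · have := h.tour_tuple hD n (t := fun _ => 0) (x := 0) (fun _ => h0V) (by simp [h0])
      refine this.mono (by simp [cost, φ]) ?_
      rintro b ⟨t, ht, s, rfl⟩
      rw [Multiset.mem_singleton] at ht
      subst ht
      exact Or.inr ⟨s, rfl⟩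
  obtain ⟨R, ⟨hRS, h0R, hR⟩, hmax⟩ := hfin.exists_maximal hne
  obtain ⟨Q, hQ⟩ := Multiset.le_iff_exists_add.1 hRS
  have hQsinks : ∀ t ∈ Q, ∀ s, φ s (t s) ∉ sinks R := by
    intro t ht s hs
    have htS := hSV t (by rw [hQ]; exact Multiset.mem_add.2 (Or.inr ht))
    have hle : t ::ₘ R ≤ S := by
      rw [hQ, ← Multiset.singleton_add, add_comm]
      exact Multiset.add_le_add_left (Multiset.singleton_le.2 ht)
    have hgood : t ::ₘ R ∈ good := by
      refine ⟨hle, Multiset.mem_cons_of_mem h0R, ?_⟩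
      have h1 := (h.tour_tuple hD n htS.1 (x := t s) (fun s' => htS.2 s' s)).rebase
        (y := φ s (t s)) (Or.inr ⟨s, rfl⟩)
      refine (hR.graft hs h1).mono ?_ ?_
      · rw [Multiset.map_cons, Multiset.sum_cons, add_comm]
      · rintro b ⟨u, hu, s', rfl⟩
        rcases Multiset.mem_cons.1 hu with rfl | hu
        · exact Or.inr (Or.inr ⟨s', rfl⟩)
        · exact Or.inl ⟨u, hu, s', rfl⟩
    have := Multiset.card_le_card (hmax hgood (Multiset.le_cons_self R t))
    simp at this
  let B₀ : Finset Site := B.filter (· ∈ sinks R)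
  have hRmap : ∀ s, R.map (fun t => φ s (t s)) = B₀.val := by
    intro s
    have h1 : (R.map fun t => φ s (t s)).filter (· ∈ sinks R) = R.map fun t => φ s (t s) := by
      rw [Multiset.filter_eq_self]
      intro b hb
      obtain ⟨t, ht, rfl⟩ := Multiset.mem_map.1 hb
      exact ⟨t, ht, s, rfl⟩
    have h2 : (Q.map fun t => φ s (t s)).filter (· ∈ sinks R) = 0 := by
      rw [Multiset.filter_eq_nil]
      intro b hb
      obtain ⟨t, ht, rfl⟩ := Multiset.mem_map.1 hb
      exact hQsinks t ht s
    rw [Finset.filter_val, ← hSmap s, hQ, Multiset.map_add, Multiset.filter_add, h1, h2,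
      add_zero]
  let a : ι := Classical.arbitrary ι
  have hcard : B₀.card = R.card := by
    rw [Finset.card_def, ← hRmap a, Multiset.card_map]
  have hsum : (R.map fun t => ∑ s, L s (φ s (t s))).sum = 0 := by
    have h1 : (R.map fun t => ∑ s, L s (φ s (t s))).sum =
        ∑ s, (R.map fun t => L s (φ s (t s))).sum :=
      Multiset.sum_map_sum
    have h2 : ∀ s, (R.map fun t => L s (φ s (t s))).sum = ∑ b ∈ B₀, L s b := by
      intro s
      have := congrArg (fun m => (m.map (L s)).sum) (hRmap s)
      simpa [Multiset.map_map, Function.comp_def] using this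
    rw [h1, Finset.sum_congr rfl fun s _ => h2 s, Finset.sum_comm]
    exact Finset.sum_eq_zero fun b _ => hL b
  have hcost : ∀ t ∈ R, cost t ≤ 2 * Fintype.card ι * (1 + M) + 2 * ∑ s, L s (φ s (t s)) := by
    intro t ht
    have h1 := (hSV t (Multiset.mem_of_le hRS ht)).2
    have h2 : ∑ s, L s (t s) = ∑ s, L s (t s - t a) := by
      simp [map_sub, Finset.sum_sub_distrib, hL]
    have h3 : -(Fintype.card ι * M) ≤ ∑ s, L s (t s) := by
      rw [h2]
      have := Finset.card_nsmul_le_sum Finset.univ (fun s => L s (t s - t a)) (-M)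
        fun s _ => (abs_le.1 (hM _ (h1 s a) s)).1
      simpa using this
    have h4 : cost t = 2 * Fintype.card ι + 2 * ∑ s, L s (φ s (t s)) - 2 * ∑ s, L s (t s) := by
      simp only [cost, Finset.sum_add_distrib, ← Finset.mul_sum, Finset.sum_sub_distrib,
        Finset.sum_const, Finset.card_univ, nsmul_eq_mul]
      ring
    rw [h4]
    linarith
  refine ⟨B₀, ?_, ?_, ?_⟩
  · rw [← Finset.card_pos, hcard, Multiset.card_pos_iff_exists_mem]
    exact ⟨_, h0R⟩
  · intro b hb
    have : b ∈ (B : Set Site) := (Finset.mem_filter.1 hb).1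
    rw [hBA] at this
    exact this.2
  · refine hR.mono ?_ fun b hb => (Finset.mem_filter.1 hb).2
    have h1 := Multiset.sum_map_le_sum_map _ _ hcost
    rw [Multiset.sum_map_add, Multiset.map_const', Multiset.sum_replicate, nsmul_eq_mul,
      Multiset.sum_map_mul_left, hsum] at h1
    rw [hcard]
    linarith

end IsExplanation

/-! ### Directions -/

/-- The additive functional `x ↦ ⟨x, u⟩` on the lattice. -/
noncomputable def pairing (u : ℝ × ℝ) : Site →+ ℝ where
  toFun x := (x.1 : ℝ) * u.1 + (x.2 : ℝ) * u.2
  map_zero' := by simp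
  map_add' x y := by push_cast [Prod.fst_add, Prod.snd_add]; ring

lemma pairing_apply (u : ℝ × ℝ) (x : Site) :
    pairing u x = (x.1 : ℝ) * u.1 + (x.2 : ℝ) * u.2 := rfl

/-- The directions `u` such that every update rule has a site strictly on the positive side
of `u`. -/
def blocking (U : Finset (Finset Site)) : Set (ℝ × ℝ) :=
  {u | ∀ X ∈ U, ∃ y ∈ X, 0 < pairing u y}

lemma isOpen_blocking (U : Finset (Finset Site)) : IsOpen (blocking U) := by
  have e : blocking U = ⋂ X ∈ U, ⋃ y ∈ X, {u | 0 < pairing u y} := by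
    ext u
    simp [blocking]
  rw [e]
  refine isOpen_biInter_finset fun X _ => isOpen_biUnion fun y _ => ?_
  refine isOpen_lt continuous_const ?_
  simp only [pairing_apply]
  fun_prop

lemma IsStableDir.exists_nonneg {U : Finset (Finset Site)} {u : ℝ × ℝ} (h : IsStableDir U u)
    {X : Finset Site} (hX : X ∈ U) : ∃ y ∈ X, 0 ≤ pairing u y := by
  by_contra! hneg
  have h0 : (0 : Site) ∈ bsClosure U (halfPlane u) := by
    refine mem_iUnion.2 ⟨1, Or.inr ⟨X, hX, fun y hy => ?_⟩⟩
    rw [add_zero]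
    exact hneg y hy
  rw [h] at h0
  simp [halfPlane] at h0

lemma eq_of_pairing_dir_eq_zero {y : Site} (hy : y ≠ 0) {a b : ℝ} (hab : |b - a| < Real.pi)
    (ha : pairing (dir a) y = 0) (hb : pairing (dir b) y = 0) : a = b := by
  simp only [pairing_apply, dir] at ha hb
  have h1 : (y.1 : ℝ) * Real.sin (b - a) = 0 := by
    rw [Real.sin_sub]
    linear_combination Real.sin b * ha - Real.sin a * hb
  have h2 : (y.2 : ℝ) * Real.sin (b - a) = 0 := by
    rw [Real.sin_sub]
    linear_combination Real.cos a * hb - Real.cos b * ha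
  have h3 : Real.sin (b - a) = 0 := by
    by_contra hs
    have e1 := (mul_eq_zero.1 h1).resolve_right hs
    have e2 := (mul_eq_zero.1 h2).resolve_right hs
    exact hy (Prod.ext (by exact_mod_cast e1) (by exact_mod_cast e2))
  have := (Real.sin_eq_zero_iff_of_lt_of_lt (abs_lt.1 hab).1 (abs_lt.1 hab).2).1 h3
  linarith

lemma IsStronglyStableAngle.exists_mem_blocking {U : Finset (Finset Site)}
    (hU : IsUpdateFamily U) {φ : ℝ} (h : IsStronglyStableAngle U φ) {δ : ℝ} (hδ : 0 < δ) :
    ∃ ψ, |ψ - φ| < δ ∧ dir ψ ∈ blocking U := by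
  obtain ⟨ε, hε, hst⟩ := h
  set η := min δ (min ε 1)
  have hη : 0 < η := lt_min hδ (lt_min hε one_pos)
  have hbad : (⋃ y ∈ U.biUnion id, {ψ ∈ Ioo φ (φ + η) | pairing (dir ψ) y = 0}).Finite := by
    refine Set.Finite.biUnion (Finset.finite_toSet _) fun y hy => Set.Subsingleton.finite ?_
    obtain ⟨X, hX, hyX⟩ := Finset.mem_biUnion.1 hy
    have hy0 : y ≠ 0 := fun he => (hU.2 X hX).2 (he ▸ hyX)
    rintro a ⟨ha, ha0⟩ b ⟨hb, hb0⟩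
    refine eq_of_pairing_dir_eq_zero hy0 ?_ ha0 hb0
    have hη1 : η ≤ 1 := (min_le_right _ _).trans (min_le_right _ _)
    have := Real.pi_gt_three
    rw [abs_lt]
    constructor <;> linarith [ha.1, ha.2, hb.1, hb.2]
  obtain ⟨ψ, hψ, hψb⟩ := ((Ioo_infinite (by linarith : φ < φ + η)).sdiff hbad).nonempty
  have habs : |ψ - φ| < η := by
    rw [abs_lt]
    constructor <;> linarith [hψ.1, hψ.2]
  refine ⟨ψ, habs.trans_le (min_le_left _ _), fun X hX => ?_⟩
  obtain ⟨y, hy, hy0⟩ := (hst ψ (habs.trans_le ((min_le_right _ _).trans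
    (min_le_left _ _)))).exists_nonneg hX
  refine ⟨y, hy, lt_of_le_of_ne hy0 fun he => hψb ?_⟩
  exact Set.mem_biUnion (Finset.mem_biUnion.2 ⟨X, hX, hy⟩) ⟨hψ, he.symm⟩

lemma Subcritical.zero_mem_convexHull {U : Finset (Finset Site)} (hU : IsUpdateFamily U)
    (h : Subcritical U) : (0 : ℝ × ℝ) ∈ convexHull ℝ (blocking U) := by
  by_contra hn
  obtain ⟨g, hg⟩ := geometric_hahn_banach_open_point (convex_convexHull ℝ _)
    (isOpen_blocking U).convexHull hn
  set z : ℂ := ⟨g (1, 0), g (0, 1)⟩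
  have hgd : ∀ ψ, g (dir ψ) = ‖z‖ * Real.cos (ψ - z.arg) := by
    intro ψ
    have e : dir ψ = Real.cos ψ • ((1 : ℝ), (0 : ℝ)) + Real.sin ψ • ((0 : ℝ), (1 : ℝ)) := by
      simp [dir]
    have h1 : ‖z‖ * Real.cos z.arg = g (1, 0) := Complex.norm_mul_cos_arg z
    have h2 : ‖z‖ * Real.sin z.arg = g (0, 1) := Complex.norm_mul_sin_arg z
    rw [e, map_add, map_smul, map_smul, ← h1, ← h2, Real.cos_sub, smul_eq_mul, smul_eq_mul]
    ring
  obtain ⟨φ, h1, h2, hφ⟩ := h (z.arg - Real.pi / 2)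
  obtain ⟨ψ, hψ, hψG⟩ := hφ.exists_mem_blocking hU
    (δ := min (φ - (z.arg - Real.pi / 2)) (z.arg - Real.pi / 2 + Real.pi - φ))
    (lt_min (by linarith) (by linarith))
  have hlt := hg _ (subset_convexHull ℝ _ hψG)
  rw [map_zero, hgd] at hlt
  obtain ⟨h3, h4⟩ := abs_lt.1 hψ
  have hcos : 0 < Real.cos (ψ - z.arg) := by
    apply Real.cos_pos_of_mem_Ioo
    constructor
    · linarith [min_le_left (φ - (z.arg - Real.pi / 2)) (z.arg - Real.pi / 2 + Real.pi - φ)]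
    · linarith [min_le_right (φ - (z.arg - Real.pi / 2)) (z.arg - Real.pi / 2 + Real.pi - φ)]
  exact absurd hlt (not_lt.2 (mul_nonneg (norm_nonneg _) hcos.le))

/-- A subcritical family admits finitely many linear functionals with sum zero such that every
update rule has, for each functional, a site where the functional is at least one. -/
lemma Subcritical.exists_functionals {U : Finset (Finset Site)} (hU : IsUpdateFamily U)
    (h : Subcritical U) :
    ∃ (ι : Type) (_ : Fintype ι) (_ : Nonempty ι) (L : ι → Site →+ ℝ),
      (∀ x, ∑ s, L s x = 0) ∧ ∀ s, ∀ X ∈ U, ∃ y ∈ X, 1 ≤ L s y := by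
  classical
  obtain ⟨ι, _, z, w, hz, -, hw, hw1, hwz⟩ :=
    eq_pos_convex_span_of_mem_convexHull (h.zero_mem_convexHull hU)
  have hne : Nonempty ι := by
    by_contra hemp
    rw [not_nonempty_iff] at hemp
    simp at hw1
  have hpos : ∀ (s : ι) (X : Finset Site), ∃ y, X ∈ U → y ∈ X ∧ 0 < pairing (z s) y := by
    intro s X
    by_cases hX : X ∈ U
    · obtain ⟨y, hy⟩ := hz ⟨s, rfl⟩ X hX
      exact ⟨y, fun _ => hy⟩
    · exact ⟨0, fun h => (hX h).elim⟩
  choose y hy using hpos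
  obtain ⟨M, hM⟩ := Finset.exists_le
    ((Finset.univ ×ˢ U).image fun q : ι × Finset Site => (w q.1 * pairing (z q.1) (y q.1 q.2))⁻¹)
  refine ⟨ι, inferInstance, hne,
    fun s => (AddMonoidHom.mulLeft (M * w s)).comp (pairing (z s)), fun x => ?_, fun s X hX => ?_⟩
  · have h1 : ∑ s, w s * (z s).1 = 0 := by
      simpa [Prod.fst_sum] using congrArg Prod.fst hwz
    have h2 : ∑ s, w s * (z s).2 = 0 := by
      simpa [Prod.snd_sum] using congrArg Prod.snd hwz
    calc ∑ s, M * w s * pairing (z s) x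
        = M * x.1 * ∑ s, w s * (z s).1 + M * x.2 * ∑ s, w s * (z s).2 := by
          rw [Finset.mul_sum, Finset.mul_sum, ← Finset.sum_add_distrib]
          refine Finset.sum_congr rfl fun s _ => ?_
          rw [pairing_apply]
          ring
      _ = 0 := by rw [h1, h2]; ring
  · obtain ⟨hyX, hy0⟩ := hy s X hX
    refine ⟨y s X, hyX, ?_⟩
    have hp := mul_pos (hw s) hy0
    have := hM _ (Finset.mem_image_of_mem _ (Finset.mem_product.2
      ⟨Finset.mem_univ s, hX⟩ : (s, X) ∈ Finset.univ ×ˢ U))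
    rw [inv_le_iff_one_le_mul₀ hp] at this
    simpa [mul_assoc] using this

/-! ### Explanations in the bootstrap process -/

lemma bsIter_subset_bsClosure (U : Finset (Finset Site)) (n : ℕ) (A : Set Site) :
    bsIter U n A ⊆ bsClosure U A :=
  subset_iUnion (fun n => bsIter U n A) n

open scoped Pointwise in
lemma exists_isExplanation {ι : Type*} {U : Finset (Finset Site)} {L : ι → Site →+ ℝ}
    (hL : ∀ s, ∀ X ∈ U, ∃ y ∈ X, 1 ≤ L s y) (A : Set Site) :
    ∃ τ f, IsExplanation A (bsClosure U A)
      (insert 0 (U.biUnion id) - insert 0 (U.biUnion id)) L τ f := by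
  classical
  set E : Finset Site := insert 0 (U.biUnion id) with hE
  have h0E : (0 : Site) ∈ E := Finset.mem_insert_self _ _
  let τ : Site → ℕ := fun x => sInf {n | x ∈ bsIter U n A}
  have key : ∀ (s : ι) (x : Site), ∃ z, x ∈ bsClosure U A → z ∈ bsClosure U A ∧ z - x ∈ E ∧
      (x ∈ A → z = x) ∧ (x ∉ A → τ z < τ x ∧ L s x + 1 ≤ L s z) := by
    intro s x
    by_cases hA : x ∈ A
    · exact ⟨x, fun hx => ⟨hx, by simpa using h0E, fun _ => rfl, fun h => (h hA).elim⟩⟩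
    · by_cases hx : x ∈ bsClosure U A
      · have hτ : x ∈ bsIter U (τ x) A := Nat.sInf_mem (mem_iUnion.1 hx)
        obtain ⟨n, hn⟩ : ∃ n, τ x = n + 1 := by
          refine Nat.exists_eq_succ_of_ne_zero fun h => hA ?_
          rw [h] at hτ
          exact hτ
        rw [hn] at hτ
        rcases hτ with hτ | ⟨X, hX, hXA⟩
        · have : τ x ≤ n := Nat.sInf_le hτ
          omega
        · obtain ⟨y, hy, hy1⟩ := hL s X hX
          refine ⟨y + x, fun _ => ⟨bsIter_subset_bsClosure U n A (hXA y hy), ?_,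
            fun h => (hA h).elim, fun _ => ⟨?_, ?_⟩⟩⟩
          · rw [add_sub_cancel_right]
            exact Finset.mem_insert_of_mem (Finset.mem_biUnion.2 ⟨X, hX, hy⟩)
          · have : τ (y + x) ≤ n := Nat.sInf_le (hXA y hy)
            omega
          · rw [map_add]
            linarith
      · exact ⟨x, fun h => (hx h).elim⟩
  choose f hf using key
  have hAV : A ⊆ bsClosure U A := bsIter_subset_bsClosure U 0 A
  refine ⟨τ, f, hAV, fun s x hx => (hf s x (hAV hx)).2.2.1 hx, fun s x hx => (hf s x hx).1,
    fun s x hx hA => ((hf s x hx).2.2.2 hA).1, fun s x hx => ?_, fun s s' x hx => ?_,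
    fun s x hx hA => ((hf s x hx).2.2.2 hA).2⟩
  · simpa using Finset.sub_mem_sub (hf s x hx).2.1 h0E
  · simpa using Finset.sub_mem_sub (hf s x hx).2.1 (hf s' x hx).2.1

/-! ### The union bound -/

lemma Tour.exists_vector {D : Finset Site} (h0 : (0 : Site) ∈ D) {x : Site} {N : ℕ}
    {S : Set Site} (h : Tour D x N S) :
    ∃ v : List.Vector D N, S ⊆ (visited x (v.toList.map Subtype.val) : Set Site) := by
  obtain ⟨l, hl, hD, -, hS⟩ := h
  have hl : l.length ≤ N := by exact_mod_cast hl
  refine ⟨⟨l.attach.map (fun d => ⟨d.1, hD d.1 d.2⟩) ++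
    List.replicate (N - l.length) ⟨0, h0⟩, by simp; omega⟩, hS.trans ?_⟩
  simp only [List.Vector.toList_mk, List.map_append, List.map_map, visited_append]
  have e : (l.attach.map (Subtype.val ∘ fun d : {d // d ∈ l} => (⟨d.1, hD d.1 d.2⟩ : D))) = l := by
    exact List.attach_map_subtype_val l
  rw [e, Finset.coe_union]
  exact subset_union_left

lemma IsBernoulli.measure_subset_siteSet {p : ℝ} {μ : Measure (Site → Bool)}
    (h : IsBernoulli p μ) (B : Finset Site) :
    μ {ω | (B : Set Site) ⊆ siteSet ω} = ENNReal.ofReal p ^ B.card := by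
  have := h B fun _ => true
  simp only [if_true, Finset.prod_const] at this
  exact this

open scoped ENNReal in
lemma IsBernoulli.measure_exists_tour_le {p : ℝ} {μ : Measure (Site → Bool)}
    (h : IsBernoulli p μ) {D : Finset Site} (h0 : (0 : Site) ∈ D) (K : ℕ) :
    μ {ω | ∃ B : Finset Site, B.Nonempty ∧ (B : Set Site) ⊆ siteSet ω ∧
      Tour D 0 ((K * B.card : ℕ) : ℝ) B} ≤
      2 * ∑' n : ℕ, (((2 * D.card) ^ K : ℕ) * ENNReal.ofReal p) ^ (n + 1) := by
  classical
  have hsub : {ω : Site → Bool | ∃ B : Finset Site, B.Nonempty ∧ (B : Set Site) ⊆ siteSet ω ∧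
      Tour D 0 ((K * B.card : ℕ) : ℝ) B} ⊆
      ⋃ n : ℕ, ⋃ v ∈ (Finset.univ : Finset (List.Vector D (K * (n + 1)))),
        ⋃ B ∈ (visited 0 (v.toList.map Subtype.val)).powersetCard (n + 1),
          {ω | (B : Set Site) ⊆ siteSet ω} := by
    rintro ω ⟨B, hB, hBω, ht⟩
    obtain ⟨n, hn⟩ := Nat.exists_eq_succ_of_ne_zero (Finset.card_pos.2 hB).ne'
    rw [hn] at ht
    obtain ⟨v, hv⟩ := ht.exists_vector h0
    simp only [mem_iUnion, exists_prop]
    exact ⟨n, v, Finset.mem_univ v, B, Finset.mem_powersetCard.2 ⟨hv, hn⟩, hBω⟩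
  refine (measure_mono hsub).trans ((measure_iUnion_le _).trans ?_)
  rw [← ENNReal.tsum_mul_left]
  refine ENNReal.tsum_le_tsum fun n => ?_
  have hB : ∀ v : List.Vector D (K * (n + 1)),
      μ (⋃ B ∈ (visited 0 (v.toList.map Subtype.val)).powersetCard (n + 1),
        {ω | (B : Set Site) ⊆ siteSet ω}) ≤
        (2 ^ (K * (n + 1) + 1) : ℕ) * ENNReal.ofReal p ^ (n + 1) := by
    intro v
    refine (measure_biUnion_finset_le _ _).trans ?_
    have e : ∀ B ∈ (visited 0 (v.toList.map Subtype.val)).powersetCard (n + 1),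
        μ {ω | (B : Set Site) ⊆ siteSet ω} = ENNReal.ofReal p ^ (n + 1) := fun B hB => by
      rw [h.measure_subset_siteSet, (Finset.mem_powersetCard.1 hB).2]
    rw [Finset.sum_congr rfl e, Finset.sum_const, nsmul_eq_mul, Finset.card_powersetCard]
    gcongr
    refine (Nat.choose_le_two_pow _ _).trans (Nat.pow_le_pow_right two_pos ?_)
    exact (card_visited_le _ _).trans (by simp)
  refine (measure_biUnion_finset_le _ _).trans ((Finset.sum_le_sum fun v _ => hB v).trans ?_)
  rw [Finset.sum_const, nsmul_eq_mul, Finset.card_univ, card_vector, Fintype.card_coe]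
  apply le_of_eq
  push_cast
  ring

/-- Let `U` be a subcritical update family in two dimensions and let
`A ~ Bin(ℤ², p)`. Then `ℙ_p(0 ∈ [A]) → 0` as `p → 0`. -/
theorem subcritical_prob_origin_infected_tendsto_zero
    (U : Finset (Finset Site)) (hU : IsUpdateFamily U) (hsub : Subcritical U) :
    ∀ ε : ℝ, 0 < ε → ∃ p₀ : ℝ, 0 < p₀ ∧ ∀ p : ℝ, 0 < p → p ≤ p₀ →
      ∀ μ : Measure (Site → Bool), IsBernoulli p μ →
        μ {ω : Site → Bool | (0 : Site) ∈ bsClosure U (siteSet ω)} < ENNReal.ofReal ε := by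
  classical
  obtain ⟨ι, _, _, L, hL0, hL1⟩ := hsub.exists_functionals hU
  open scoped Pointwise in
  set D : Finset Site := insert 0 (U.biUnion id) - insert 0 (U.biUnion id) with hD
  have h0D : (0 : Site) ∈ D := by
    have := Finset.sub_mem_sub (Finset.mem_insert_self (0 : Site) (U.biUnion id))
      (Finset.mem_insert_self (0 : Site) (U.biUnion id))
    rwa [sub_zero] at this
  have hneg : ∀ d ∈ D, -d ∈ D := by
    intro d hd
    obtain ⟨a, ha, b, hb, rfl⟩ := Finset.mem_sub.1 hd
    rw [neg_sub]
    exact Finset.sub_mem_sub hb ha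
  obtain ⟨M, hM⟩ := Finset.exists_le ((D ×ˢ Finset.univ).image fun q : Site × ι => |L q.2 q.1|)
  have hM : ∀ d ∈ D, ∀ s, |L s d| ≤ M := fun d hd s =>
    hM _ (Finset.mem_image_of_mem (fun q : Site × ι => |L q.2 q.1|)
      (Finset.mem_product.2 ⟨hd, Finset.mem_univ s⟩ : (d, s) ∈ D ×ˢ Finset.univ))
  obtain ⟨K, hK⟩ := exists_nat_ge (2 * Fintype.card ι * (1 + M))
  have htour : ∀ ω : Site → Bool, (0 : Site) ∈ bsClosure U (siteSet ω) →
      ∃ B : Finset Site, B.Nonempty ∧ (B : Set Site) ⊆ siteSet ω ∧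
        Tour D 0 ((K * B.card : ℕ) : ℝ) B := by
    intro ω h0
    obtain ⟨τ, f, hf⟩ := exists_isExplanation hL1 (siteSet ω)
    obtain ⟨B, hB, hBA, ht⟩ := hf.exists_tour hneg h0D hL0 hM h0
    refine ⟨B, hB, hBA, ht.mono ?_ Subset.rfl⟩
    push_cast
    gcongr
  set c : ℕ := (2 * D.card) ^ K
  have hc : 0 < c := pow_pos (Nat.mul_pos two_pos (Finset.card_pos.2 ⟨0, h0D⟩)) K
  have hcR : (0 : ℝ) < c := Nat.cast_pos.2 hc
  intro ε hε
  refine ⟨min (1 / 2) (ε / 8) / c, by positivity, fun p hp0 hp μ hμ => ?_⟩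
  have hcp : c * p ≤ min (1 / 2) (ε / 8) := by
    rwa [le_div_iff₀' hcR] at hp
  set r : ENNReal := c * ENNReal.ofReal p with hr
  have hr' : r = ENNReal.ofReal (c * p) := by
    rw [hr, ENNReal.ofReal_mul hcR.le, ENNReal.ofReal_natCast]
  have hr2 : r ≤ 2⁻¹ := by
    rw [hr']
    refine (ENNReal.ofReal_le_ofReal (hcp.trans (min_le_left _ _))).trans ?_
    rw [one_div, ENNReal.ofReal_inv_of_pos two_pos, ENNReal.ofReal_ofNat]
  calc μ {ω : Site → Bool | (0 : Site) ∈ bsClosure U (siteSet ω)}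
      ≤ μ {ω | ∃ B : Finset Site, B.Nonempty ∧ (B : Set Site) ⊆ siteSet ω ∧
          Tour D 0 ((K * B.card : ℕ) : ℝ) B} := measure_mono htour
    _ ≤ 2 * ∑' n : ℕ, r ^ (n + 1) := hμ.measure_exists_tour_le h0D K
    _ = 2 * (r * (1 - r)⁻¹) := by rw [ENNReal.tsum_geometric_add_one]
    _ ≤ 2 * (r * 2) := by
      gcongr
      rw [ENNReal.inv_le_iff_inv_le]
      refine le_trans ?_ (tsub_le_tsub_left hr2 1)
      rw [ENNReal.one_sub_inv_two]
    _ = ENNReal.ofReal (4 * (c * p)) := by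
      rw [hr', ENNReal.ofReal_mul (by norm_num : (0 : ℝ) ≤ 4), ENNReal.ofReal_ofNat]
      ring
    _ < ENNReal.ofReal ε := by
      rw [ENNReal.ofReal_lt_ofReal_iff hε]
      linarith [hcp.trans (min_le_right _ _)]
end

section
/- Let U be a subcritical update family in two dimensions. Then p_c(ℤ², U) = 1 if and only if S(U) = S¹. -/
open Set MeasureTheory

theorem bsIter_mono (U : Finset (Finset Site)) (A : Set Site) : Monotone fun n => bsIter U n A :=
  monotone_nat_of_le_succ fun _ => subset_union_left

theorem subset_bsClosure (U : Finset (Finset Site)) (A : Set Site) : A ⊆ bsClosure U A :=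
  subset_iUnion (fun n => bsIter U n A) 0

theorem mem_bsClosure_of_rule {U : Finset (Finset Site)} {A : Set Site} {X : Finset Site}
    (hX : X ∈ U) {x : Site} (h : ∀ y ∈ X, y + x ∈ bsClosure U A) : x ∈ bsClosure U A := by
  simp only [bsClosure, mem_iUnion] at h ⊢
  choose! n hn using h
  refine ⟨X.sup n + 1, Or.inr ⟨X, hX, fun y hy => ?_⟩⟩
  exact bsIter_mono U A (Finset.le_sup hy) (hn y hy)

/-- A set that meets every translated rule based at one of its sites stays healthy forever. -/
theorem disjoint_bsClosure {U : Finset (Finset Site)} {A K : Set Site}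
    (hK : ∀ x ∈ K, ∀ X ∈ U, ∃ y ∈ X, y + x ∈ K) (hA : Disjoint A K) :
    Disjoint (bsClosure U A) K := by
  refine disjoint_iUnion_left.2 fun n => ?_
  induction n with
  | zero => exact hA
  | succ n ih =>
    refine disjoint_union_left.2 ⟨ih, Set.disjoint_left.2 ?_⟩
    rintro x ⟨X, hX, h⟩ hx
    obtain ⟨y, hy, hyK⟩ := hK x hx X hX
    exact Set.disjoint_left.1 ih (h y hy) hyK

theorem isStableDir_iff (U : Finset (Finset Site)) (u : ℝ × ℝ) :
    IsStableDir U u ↔ ∀ X ∈ U, ∃ y ∈ X, 0 ≤ (y.1 : ℝ) * u.1 + (y.2 : ℝ) * u.2 := by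
  constructor
  · intro h X hX
    by_contra! hc
    have h0 : (0 : Site) ∈ bsClosure U (halfPlane u) :=
      mem_bsClosure_of_rule hX fun y hy => subset_bsClosure _ _ (by simpa [halfPlane] using hc y hy)
    rw [h] at h0
    simp [halfPlane] at h0
  · intro h
    refine Subset.antisymm ?_ (subset_bsClosure _ _)
    refine disjoint_compl_right_iff_subset.1 (disjoint_bsClosure ?_ disjoint_compl_right)
    intro x hx X hX
    obtain ⟨y, hy, hy0⟩ := h X hX
    refine ⟨y, hy, ?_⟩
    simp only [halfPlane, mem_compl_iff, mem_ofPred_eq, not_lt, Prod.fst_add, Prod.snd_add,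
      Int.cast_add] at hx ⊢
    linarith

/-- A finite set of sites contained in no open half-plane through the origin carries a convex
combination equal to `0`. -/
theorem exists_convex_relation {X : Finset Site} (hne : X.Nonempty)
    (h : ∀ u : ℝ × ℝ, u ≠ 0 → ∃ y ∈ X, 0 ≤ (y.1 : ℝ) * u.1 + (y.2 : ℝ) * u.2) :
    ∃ w : Site → ℝ, (∀ y ∈ X, 0 ≤ w y) ∧ ∑ y ∈ X, w y = 1 ∧
      ∑ y ∈ X, w y * (y.1 : ℝ) = 0 ∧ ∑ y ∈ X, w y * (y.2 : ℝ) = 0 := by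
  classical
  let e : Site → ℝ × ℝ := fun y => ((y.1 : ℝ), (y.2 : ℝ))
  have he : Function.Injective e := by
    intro a b hab
    simp only [e, Prod.mk.injEq, Int.cast_inj] at hab
    exact Prod.ext hab.1 hab.2
  have h0 : (0 : ℝ × ℝ) ∈ convexHull ℝ (X.image e : Set (ℝ × ℝ)) := by
    by_contra hc
    obtain ⟨f, s, hf, hs⟩ := geometric_hahn_banach_closed_point (convex_convexHull ℝ _)
      ((X.image e).finite_toSet.isCompact_convexHull (𝕜 := ℝ)).isClosed hc
    rw [map_zero] at hs
    have hfe (y : Site) : f (e y) = (y.1 : ℝ) * f (1, 0) + (y.2 : ℝ) * f (0, 1) := by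
      have : e y = (y.1 : ℝ) • ((1, 0) : ℝ × ℝ) + (y.2 : ℝ) • ((0, 1) : ℝ × ℝ) := by
        simp [e]
      rw [this, map_add, map_smul, map_smul, smul_eq_mul, smul_eq_mul]
    have hneg : ∀ y ∈ X, (y.1 : ℝ) * f (1, 0) + (y.2 : ℝ) * f (0, 1) < 0 := fun y hy => by
      rw [← hfe]
      exact (hf _ (subset_convexHull ℝ _ (by simpa using ⟨y.1, y.2, hy, rfl⟩))).trans hs
    obtain ⟨y, hy, hy0⟩ := h (f (1, 0), f (0, 1)) (by
      intro hu
      obtain ⟨y, hy⟩ := hne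
      have := hneg y hy
      simp only [Prod.mk_eq_zero] at hu
      simp [hu] at this)
    exact (hneg y hy).not_ge hy0
  obtain ⟨w, hw0, hw1, hw⟩ := Finset.mem_convexHull'.1 h0
  rw [Finset.sum_image he.injOn] at hw1 hw
  refine ⟨w ∘ e, fun y hy => hw0 _ (Finset.mem_image_of_mem e hy), hw1, ?_, ?_⟩
  · simpa [Prod.fst_sum, e] using congrArg Prod.fst hw
  · simpa [Prod.snd_sum, e] using congrArg Prod.snd hw

theorem abs_sum_floor_mul_le {X : Finset Site} {w : Site → ℝ} (hw : ∀ y ∈ X, 0 ≤ w y)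
    {g : Site → ℤ} (hg : ∑ y ∈ X, w y * (g y : ℝ) = 0) (m : ℕ) :
    |∑ y ∈ X, (⌊m * w y⌋₊ : ℤ) * g y| ≤ ∑ y ∈ X, |g y| := by
  have key : ((∑ y ∈ X, (⌊m * w y⌋₊ : ℤ) * g y : ℤ) : ℝ)
      = ∑ y ∈ X, ((⌊m * w y⌋₊ : ℝ) - m * w y) * g y := by
    have : ∑ y ∈ X, (m * w y) * (g y : ℝ) = 0 := by
      simp_rw [mul_assoc, ← Finset.mul_sum, hg, mul_zero]
    simp [sub_mul, Finset.sum_sub_distrib, this]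
  have : |((∑ y ∈ X, (⌊m * w y⌋₊ : ℤ) * g y : ℤ) : ℝ)| ≤ ((∑ y ∈ X, |g y| : ℤ) : ℝ) := by
    rw [key]
    push_cast
    refine (Finset.abs_sum_le_sum_abs _ _).trans (Finset.sum_le_sum fun y hy => ?_)
    rw [abs_mul]
    refine mul_le_of_le_one_left (abs_nonneg _) (abs_le.2 ⟨?_, ?_⟩)
    · linarith [Nat.lt_floor_add_one (m * w y)]
    · linarith [Nat.floor_le (mul_nonneg m.cast_nonneg (hw y hy))]
  exact_mod_cast this

/-- A finite set of sites contained in no open half-plane through the origin satisfies a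
nontrivial linear relation with natural coefficients. -/
theorem exists_nat_relation {X : Finset Site} (hne : X.Nonempty)
    (h : ∀ u : ℝ × ℝ, u ≠ 0 → ∃ y ∈ X, 0 ≤ (y.1 : ℝ) * u.1 + (y.2 : ℝ) * u.2) :
    ∃ c : Site → ℕ, (∃ y ∈ X, 0 < c y) ∧ ∑ y ∈ X, c y • y = 0 := by
  obtain ⟨w, hw0, hw1, hwa, hwb⟩ := exists_convex_relation hne h
  obtain ⟨z, hz, hwz⟩ : ∃ z ∈ X, 0 < w z :=
    Finset.exists_lt_of_sum_lt (f := fun _ => (0 : ℝ)) (by simp [hw1])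
  obtain ⟨q, hq⟩ := exists_nat_ge (1 / w z)
  rw [div_le_iff₀ hwz] at hq
  let v : ℕ → Site := fun k => ∑ y ∈ X, ⌊((k * q : ℕ) : ℝ) * w y⌋₊ • y
  let b : Site := (∑ y ∈ X, |y.1|, ∑ y ∈ X, |y.2|)
  have hv : MapsTo v univ (Icc (-b) b) := by
    intro k _
    have h1 := abs_le.1 (abs_sum_floor_mul_le hw0 (g := Prod.fst) hwa (k * q))
    have h2 := abs_le.1 (abs_sum_floor_mul_le hw0 (g := Prod.snd) hwb (k * q))
    simp only [mem_Icc, Prod.le_def, v, b, Prod.fst_sum, Prod.snd_sum, Prod.fst_neg,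
      Prod.snd_neg, nsmul_eq_mul]
    exact ⟨⟨h1.1, h2.1⟩, h1.2, h2.2⟩
  obtain ⟨k, -, l, -, hkl, hvkl⟩ :=
    infinite_univ.exists_lt_map_eq_of_mapsTo hv (finite_Icc _ _)
  have hmono : ∀ y ∈ X, ⌊((k * q : ℕ) : ℝ) * w y⌋₊ ≤ ⌊((l * q : ℕ) : ℝ) * w y⌋₊ :=
    fun y hy => Nat.floor_le_floor (by have := hw0 y hy; gcongr)
  refine ⟨fun y => ⌊((l * q : ℕ) : ℝ) * w y⌋₊ - ⌊((k * q : ℕ) : ℝ) * w y⌋₊, ⟨z, hz, ?_⟩, ?_⟩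
  · have h1 : ⌊((k * q : ℕ) : ℝ) * w z⌋₊ + 1 ≤ ⌊((l * q : ℕ) : ℝ) * w z⌋₊ := by
      rw [← Nat.floor_add_one (by positivity)]
      refine Nat.floor_le_floor ?_
      have : (k : ℝ) + 1 ≤ l := by exact_mod_cast hkl
      push_cast
      nlinarith
    exact Nat.sub_pos_of_lt h1
  · have : v k + ∑ y ∈ X, (⌊((l * q : ℕ) : ℝ) * w y⌋₊ - ⌊((k * q : ℕ) : ℝ) * w y⌋₊) • y = v l := by
      simp only [v, ← Finset.sum_add_distrib, ← add_smul]
      exact Finset.sum_congr rfl fun y hy => by rw [Nat.add_sub_cancel' (hmono y hy)]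
    rw [← hvkl] at this
    simpa using this

/-- If every rule satisfies a nontrivial relation with natural coefficients, then some finite
set of healthy sites stays healthy forever. -/
theorem exists_finset_blocking {U : Finset (Finset Site)}
    (h : ∀ X ∈ U, ∃ c : Site → ℕ, (∃ y ∈ X, 0 < c y) ∧ ∑ y ∈ X, c y • y = 0) :
    ∃ K : Finset Site, K.Nonempty ∧ ∀ x ∈ K, ∀ X ∈ U, ∃ y ∈ X, y + x ∈ K := by
  classical
  choose! c hc hc0 using h
  let Y : Finset Site := U.biUnion id
  let N : ℕ := ∑ X ∈ U, ∑ y ∈ X, c X y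
  let S : Set Site := {x | ∃ n : Site → ℕ, (∀ y, n y ≤ N) ∧ ∑ y ∈ Y, n y • y = x}
  have hS : S.Finite := by
    refine (finite_range fun n : Y → Fin (N + 1) => ∑ y, (n y : ℕ) • (y : Site)).subset ?_
    rintro x ⟨n, hn, rfl⟩
    exact ⟨fun y => ⟨n y, Nat.lt_succ_of_le (hn y)⟩, Finset.sum_coe_sort Y fun y => n y • y⟩
  have hcN : ∀ X ∈ U, ∀ y ∈ X, c X y ≤ N := fun X hX y hy =>
    (Finset.single_le_sum (f := c X) (fun _ _ => Nat.zero_le _) hy).trans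
      (Finset.single_le_sum (f := fun X => ∑ y ∈ X, c X y) (fun _ _ => Nat.zero_le _) hX)
  have hstep : ∀ X ∈ U, ∀ y ∈ X, ∀ n : Site → ℕ, (∀ y, n y ≤ N) → n y < N →
      y + ∑ z ∈ Y, n z • z ∈ S := by
    intro X hX y hy n hn hny
    refine ⟨fun z => if z = y then n z + 1 else n z, fun z => ?_, ?_⟩
    · dsimp only
      split_ifs with hz
      · exact hz ▸ hny
      · exact hn z
    · have hyY : y ∈ Y := Finset.mem_biUnion.2 ⟨X, hX, hy⟩
      rw [← Finset.add_sum_erase _ _ hyY, ← Finset.add_sum_erase (a := y) _ _ hyY]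
      simp only [if_true]
      rw [succ_nsmul', add_assoc]
      congr 2
      exact Finset.sum_congr rfl fun z hz => by rw [if_neg (Finset.ne_of_mem_erase hz)]
  refine ⟨hS.toFinset, ⟨0, hS.mem_toFinset.2 ⟨0, by simp, by simp⟩⟩, ?_⟩
  simp only [Finite.mem_toFinset]
  rintro x ⟨n, hn, rfl⟩ X hX
  by_cases hlt : ∃ y ∈ X, n y < N
  · obtain ⟨y, hy, hny⟩ := hlt
    exact ⟨y, hy, hstep X hX y hy n hn hny⟩
  push Not at hlt
  obtain ⟨y, hy, hcy⟩ := hc X hX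
  let n' : Site → ℕ := fun z => if z ∈ X then n z - c X z else n z
  have hn' : ∑ z ∈ Y, n' z • z = ∑ z ∈ Y, n z • z := by
    have hXY : X ⊆ Y := Finset.subset_biUnion_of_mem id hX
    have hrel : ∑ z ∈ Y, (if z ∈ X then c X z else 0) • z = 0 := by
      rw [← hc0 X hX]
      symm
      rw [← Finset.sum_subset hXY fun z _ hz => by rw [if_neg hz, zero_smul]]
      exact Finset.sum_congr rfl fun z hz => by rw [if_pos hz]
    rw [← add_zero (∑ z ∈ Y, n' z • z), ← hrel, ← Finset.sum_add_distrib]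
    refine Finset.sum_congr rfl fun z _ => ?_
    rw [← add_smul]
    by_cases hz : z ∈ X
    · simp only [n', if_pos hz]
      rw [Nat.sub_add_cancel ((hcN X hX z hz).trans (hlt z hz))]
    · simp only [n', if_neg hz, add_zero]
  refine ⟨y, hy, hn' ▸ hstep X hX y hy n' (fun z => ?_) ?_⟩
  · dsimp only [n']
    split_ifs
    · exact (Nat.sub_le _ _).trans (hn z)
    · exact hn z
  · have := hn y
    have := hcN X hX y hy
    simp only [n', if_pos hy]
    omega

theorem exists_isBernoulli {p : ℝ} (hp : p ∈ Icc (0 : ℝ) 1) :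
    ∃ μ : Measure (Site → Bool), IsBernoulli p μ := by
  let ν : Measure Bool :=
    ENNReal.ofReal p • Measure.dirac true + ENNReal.ofReal (1 - p) • Measure.dirac false
  have hν : IsProbabilityMeasure ν := ⟨by
    simp only [ν, Measure.coe_add, Measure.coe_smul, Pi.add_apply, Pi.smul_apply, measure_univ,
      smul_eq_mul, mul_one]
    rw [← ENNReal.ofReal_add hp.1 (by linarith [hp.2])]
    simp⟩
  refine ⟨Measure.infinitePi fun _ => ν, fun s f => ?_⟩
  have : {ω : Site → Bool | ∀ x ∈ s, ω x = f x} = Set.pi s fun x => {f x} := by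
    ext ω; simp [Set.mem_pi]
  rw [this, Measure.infinitePi_pi _ fun _ _ => MeasurableSet.singleton _]
  refine Finset.prod_congr rfl fun x _ => ?_
  cases f x <;> simp [ν]

namespace IsBernoulli

variable {p : ℝ} {μ : Measure (Site → Bool)}

theorem isProbabilityMeasure (h : IsBernoulli p μ) : IsProbabilityMeasure μ :=
  ⟨by simpa using h ∅ fun _ => true⟩

theorem measure_healthy (h : IsBernoulli p μ) (T : Finset Site) :
    μ {ω | ∀ x ∈ T, ω x = false} = ENNReal.ofReal (1 - p) ^ T.card := by
  simpa using h T fun _ => false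

/-- The existence of a finite blocking set prevents almost sure percolation. -/
theorem measure_percolates_lt_one (h : IsBernoulli p μ) (hp : p < 1)
    {U : Finset (Finset Site)} {K : Finset Site} (hne : K.Nonempty)
    (hK : ∀ x ∈ K, ∀ X ∈ U, ∃ y ∈ X, y + x ∈ K) :
    μ {ω | Percolates U (siteSet ω)} < 1 := by
  have := h.isProbabilityMeasure
  let E : Set (Site → Bool) := {ω | ∀ x ∈ K, ω x = false}
  have hE : MeasurableSet E := by
    have : E = Set.pi K fun _ => {false} := by ext ω; simp [E, Set.mem_pi]
    exact this ▸ MeasurableSet.pi K.countable_toSet fun _ _ => MeasurableSet.singleton _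
  have hsub : {ω | Percolates U (siteSet ω)} ⊆ Eᶜ := by
    intro ω hω hωE
    obtain ⟨x, hx⟩ := hne
    have hdis : Disjoint (bsClosure U (siteSet ω)) (K : Set Site) :=
      disjoint_bsClosure hK (Set.disjoint_left.2 fun x hx hxK => by
        simp [siteSet, hωE x hxK] at hx)
    exact Set.disjoint_left.1 hdis (hω.symm ▸ mem_univ x) hx
  refine (measure_mono hsub).trans_lt ?_
  rw [prob_compl_eq_one_sub hE]
  refine ENNReal.sub_lt_self ENNReal.one_ne_top one_ne_zero ?_
  rw [h.measure_healthy]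
  exact pow_ne_zero _ (by simpa using hp)

theorem measure_percolates_of_one (h : IsBernoulli 1 μ) (U : Finset (Finset Site)) :
    μ {ω | Percolates U (siteSet ω)} = 1 := by
  have := h.isProbabilityMeasure
  have hae : ∀ᵐ ω ∂μ, ∀ x, ω x = true := by
    refine ae_all_iff.2 fun x => ?_
    have hx := h.measure_healthy {x}
    simpa [ae_iff] using hx
  rw [← measure_univ (μ := μ)]
  refine measure_congr (Filter.eventuallyEq_univ.2 (hae.mono fun ω hω => ?_))
  exact eq_univ_of_forall fun x => subset_bsClosure _ _ (hω x)

end IsBernoulli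

/-- There is a path of `n` healthy sites starting from `x` with steps in `X`, followed by one more
step. -/
def HasHealthyPath (X : Finset Site) (ω : Site → Bool) : ℕ → Site → Prop
  | 0, _ => True
  | n + 1, x => ω x = false ∧ ∃ y ∈ X, HasHealthyPath X ω n (y + x)

theorem hasHealthyPath_of_notMem_bsClosure {U : Finset (Finset Site)} {X : Finset Site}
    (hX : X ∈ U) {ω : Site → Bool} (n : ℕ) {x : Site} (hx : x ∉ bsClosure U (siteSet ω)) :
    HasHealthyPath X ω n x := by
  induction n generalizing x with
  | zero => trivial
  | succ n ih =>
    refine ⟨by simpa [siteSet] using fun h => hx (subset_bsClosure _ _ h), ?_⟩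
    by_contra! hc
    exact hx (mem_bsClosure_of_rule hX fun y hy => by_contra fun hyx => hc y hy (ih hyx))

namespace IsBernoulli

variable {p : ℝ} {μ : Measure (Site → Bool)}

theorem measure_healthyPath_le (h : IsBernoulli p μ) {X : Finset Site} {u : ℝ × ℝ}
    (hX : ∀ y ∈ X, (y.1 : ℝ) * u.1 + (y.2 : ℝ) * u.2 < 0) (n : ℕ) (x : Site) (T : Finset Site)
    (hT : ∀ t ∈ T, (x.1 : ℝ) * u.1 + (x.2 : ℝ) * u.2 < (t.1 : ℝ) * u.1 + (t.2 : ℝ) * u.2) :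
    μ {ω | (∀ t ∈ T, ω t = false) ∧ HasHealthyPath X ω n x} ≤
      ENNReal.ofReal (1 - p) ^ T.card * (X.card * ENNReal.ofReal (1 - p)) ^ n := by
  classical
  induction n generalizing x T with
  | zero => simpa only [HasHealthyPath, and_true, pow_zero, mul_one] using (h.measure_healthy T).le
  | succ n ih =>
    have hxT : x ∉ T := fun hx => lt_irrefl _ (hT x hx)
    have hsub : {ω | (∀ t ∈ T, ω t = false) ∧ HasHealthyPath X ω (n + 1) x} ⊆
        ⋃ y ∈ X, {ω | (∀ t ∈ insert x T, ω t = false) ∧ HasHealthyPath X ω n (y + x)} := by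
      rintro ω ⟨hωT, hωx, y, hy, hω⟩
      simp only [mem_iUnion]
      exact ⟨y, hy, by simpa using ⟨hωx, fun a b => hωT (a, b)⟩, hω⟩
    calc _ ≤ _ := measure_mono hsub
      _ ≤ _ := measure_biUnion_finset_le _ _
      _ ≤ ∑ _y ∈ X, ENNReal.ofReal (1 - p) ^ (T.card + 1)
            * (X.card * ENNReal.ofReal (1 - p)) ^ n := by
        refine Finset.sum_le_sum fun y hy => ?_
        rw [← Finset.card_insert_of_notMem hxT]
        refine ih _ _ fun t ht => ?_
        have hyx := hX y hy
        simp only [Prod.fst_add, Prod.snd_add, Int.cast_add]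
        rcases Finset.mem_insert.1 ht with rfl | ht
        · linarith
        · linarith [hT t ht]
      _ = _ := by
        rw [Finset.sum_const, nsmul_eq_mul]
        ring

/-- If some rule lies in an open half-plane through the origin, then percolation occurs almost
surely at high density. -/
theorem measure_percolates_eq_one (h : IsBernoulli p μ) {U : Finset (Finset Site)}
    {X : Finset Site} (hXU : X ∈ U) {u : ℝ × ℝ}
    (hX : ∀ y ∈ X, (y.1 : ℝ) * u.1 + (y.2 : ℝ) * u.2 < 0)
    (hp : X.card * ENNReal.ofReal (1 - p) < 1) :
    μ {ω | Percolates U (siteSet ω)} = 1 := by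
  have := h.isProbabilityMeasure
  have hae : ∀ᵐ ω ∂μ, ∀ x, x ∈ bsClosure U (siteSet ω) := by
    refine ae_all_iff.2 fun x => ?_
    refine le_antisymm (ge_of_tendsto'
      (ENNReal.tendsto_pow_atTop_nhds_zero_of_lt_one hp) fun n => ?_) zero_le
    refine (measure_mono fun ω hω => ?_).trans
      ((h.measure_healthyPath_le hX n x ∅ (by simp)).trans_eq (by simp))
    exact ⟨by simp, hasHealthyPath_of_notMem_bsClosure hXU n hω⟩
  rw [← measure_univ (μ := μ)]
  exact measure_congr (Filter.eventuallyEq_univ.2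
    (hae.mono fun ω hω => eq_univ_of_forall hω))

end IsBernoulli

theorem critProb_lt_one_of_not_isStableDir {U : Finset (Finset Site)} {u : ℝ × ℝ}
    (hu : ¬ IsStableDir U u) : critProb U < 1 := by
  rw [isStableDir_iff] at hu
  push Not at hu
  obtain ⟨X, hXU, hX⟩ := hu
  have hpos : (0 : ℝ) < X.card + 1 := by positivity
  have hle : 1 / ((X.card : ℝ) + 1) ≤ 1 := by
    rw [div_le_one hpos]
    exact le_add_of_nonneg_left X.card.cast_nonneg
  have hlt : 0 < 1 / ((X.card : ℝ) + 1) := by positivity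
  refine lt_of_le_of_lt (b := 1 - 1 / ((X.card : ℝ) + 1)) ?_ (by linarith)
  refine csInf_le ⟨0, fun p hp => hp.1.1⟩ ⟨⟨by linarith, by linarith⟩, fun μ hμ => ?_⟩
  refine hμ.measure_percolates_eq_one hXU hX ?_
  rw [sub_sub_cancel, ← ENNReal.ofReal_natCast, ← ENNReal.ofReal_mul X.card.cast_nonneg,
    ENNReal.ofReal_lt_one, mul_one_div, div_lt_one hpos]
  exact lt_add_one _

theorem critProb_eq_one_of_forall_isStableDir {U : Finset (Finset Site)} (hU : IsUpdateFamily U)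
    (hst : ∀ u : ℝ × ℝ, u.1 ^ 2 + u.2 ^ 2 = 1 → IsStableDir U u) : critProb U = 1 := by
  have hrel : ∀ X ∈ U, ∃ c : Site → ℕ, (∃ y ∈ X, 0 < c y) ∧ ∑ y ∈ X, c y • y = 0 := by
    refine fun X hX => exists_nat_relation (hU.2 X hX).1 fun u hu => ?_
    have hs : 0 < u.1 ^ 2 + u.2 ^ 2 := by
      by_contra! hc
      exact hu (Prod.ext (by simp only [Prod.fst_zero]; nlinarith)
        (by simp only [Prod.snd_zero]; nlinarith))
    have hr := Real.sqrt_pos.2 hs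
    obtain ⟨y, hy, hy0⟩ := (isStableDir_iff U _).1
      (hst (u.1 / √(u.1 ^ 2 + u.2 ^ 2), u.2 / √(u.1 ^ 2 + u.2 ^ 2)) (by
        simp only [div_pow, Real.sq_sqrt hs.le]
        rw [← add_div, div_self hs.ne'])) X hX
    refine ⟨y, hy, ?_⟩
    rw [mul_div_assoc', mul_div_assoc', ← add_div] at hy0
    simpa [hr.ne'] using mul_nonneg hy0 hr.le
  obtain ⟨K, hne, hK⟩ := exists_finset_blocking hrel
  have : {p : ℝ | p ∈ Set.Icc (0 : ℝ) 1 ∧ ∀ μ : Measure (Site → Bool), IsBernoulli p μ →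
      μ {ω : Site → Bool | Percolates U (siteSet ω)} = 1} = {1} := by
    ext p
    refine ⟨fun ⟨hp, hμ⟩ => ?_, ?_⟩
    · obtain ⟨μ, hB⟩ := exists_isBernoulli hp
      by_contra hp1
      exact (hB.measure_percolates_lt_one (lt_of_le_of_ne hp.2 hp1) hne hK).ne (hμ μ hB)
    · rintro rfl
      exact ⟨by simp, fun μ hμ => hμ.measure_percolates_of_one U⟩
  rw [critProb, this, csInf_singleton]

/-- Let `U` be a subcritical update family in two dimensions.
Then `p_c(ℤ², U) = 1` if and only if `S(U) = S¹`, i.e. iff every direction of the unit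
circle is stable for `U`. -/
theorem subcritical_critProb_eq_one_iff
    (U : Finset (Finset Site)) (hU : IsUpdateFamily U) (hsub : Subcritical U) :
    critProb U = 1 ↔ ∀ u : ℝ × ℝ, u.1 ^ 2 + u.2 ^ 2 = 1 → IsStableDir U u := by
  refine ⟨fun h u _ => ?_, critProb_eq_one_of_forall_isStableDir hU⟩
  by_contra hu
  exact (critProb_lt_one_of_not_isStableDir hu).ne h
end
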